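/- For real μ > 0, y > 0, and 0 < (δ-ν)/μ < 2 with α > μ: ∫₀^∞ t^{δ-ν-1} (y^{2μ} + t^{2μ})^{-α/(2μ)} sin[(α/μ) arctan(t^μ/y^μ)] dt = (1/(μ y^{α+ν-δ})) B((α-δ+ν)/μ, (δ-ν)/μ) sin[(π/2)((δ-ν)/μ)], where B is the Beta function. -/

import Mathlib

open MeasureTheory Set

lemma integrableOn_rpow_mul_exp_neg_mul {s r : ℝ} (hs : 0 < s) (hr : 0 < r) :
    IntegrableOn (fun t : ℝ => t ^ (s - 1) * Real.exp (-(r * t))) (Ioi 0) := by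
  simpa using integrableOn_rpow_mul_exp_neg_mul_rpow (by linarith : -1 < s - 1) one_pos hr

lemma ofReal_mul_cpow {r : ℝ} (hr : 0 < r) {z : ℂ} (hz : z ≠ 0) (s : ℝ) :
    ((r : ℂ) * z) ^ (s : ℂ) = ((r ^ s : ℝ) : ℂ) * z ^ (s : ℂ) := by
  have hr0 : (r : ℂ) ≠ 0 := Complex.ofReal_ne_zero.2 hr.ne'
  rw [Complex.cpow_def_of_ne_zero (mul_ne_zero hr0 hz), Complex.cpow_def_of_ne_zero hz,
    Complex.log_ofReal_mul hr hz, add_mul, Complex.exp_add, Real.rpow_def_of_pos hr]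
  push_cast
  rfl

lemma integral_rpow_mul_cexp_neg_mul_Ioi {s : ℝ} (hs : 0 < s) {z : ℂ} (hz : 0 < z.re) :
    ∫ t in Ioi (0 : ℝ), ((t ^ (s - 1) : ℝ) : ℂ) * Complex.exp (-(z * t)) =
      (1 / z) ^ (s : ℂ) * (Real.Gamma s : ℂ) := by
  let m : Measure ℝ :=
    (volume.restrict (Ioi 0)).withDensity fun t => ENNReal.ofReal (t ^ (s - 1))
  have meas : Measurable fun t : ℝ => ENNReal.ofReal (t ^ (s - 1)) := by fun_prop
  have fin : ∀ᵐ t : ℝ ∂volume.restrict (Ioi 0), ENNReal.ofReal (t ^ (s - 1)) < ⊤ := by simp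
  have toReal {t : ℝ} (ht : t ∈ Ioi (0 : ℝ)) :
      (ENNReal.ofReal (t ^ (s - 1))).toReal = t ^ (s - 1) :=
    ENNReal.toReal_ofReal (Real.rpow_nonneg (le_of_lt ht) _)
  have mgf_eq (w : ℂ) : ProbabilityTheory.complexMGF (fun t : ℝ => -t) m w =
      ∫ t in Ioi (0 : ℝ), ((t ^ (s - 1) : ℝ) : ℂ) * Complex.exp (-(w * t)) := by
    rw [ProbabilityTheory.complexMGF, integral_withDensity_eq_integral_toReal_smul meas fin]
    refine setIntegral_congr_fun measurableSet_Ioi fun t ht => ?_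
    simp only [toReal ht, Complex.real_smul, Complex.ofReal_neg, mul_neg]
  have strip : Ioi (0 : ℝ) ⊆
      interior (ProbabilityTheory.integrableExpSet (fun t : ℝ => -t) m) := by
    refine interior_maximal (fun r hr => ?_) isOpen_Ioi
    change Integrable _ _
    rw [integrable_withDensity_iff_integrable_smul' meas fin]
    refine (integrableOn_rpow_mul_exp_neg_mul hs hr).congr_fun (fun t ht => ?_) measurableSet_Ioi
    simp only [toReal ht, smul_eq_mul, mul_neg]
  let U : Set ℂ := {w | 0 < w.re}
  have hU : IsOpen U := isOpen_lt continuous_const Complex.continuous_re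
  have analytic_left : AnalyticOnNhd ℂ (ProbabilityTheory.complexMGF (fun t : ℝ => -t) m) U :=
    fun w hw => ProbabilityTheory.analyticAt_complexMGF (strip hw)
  have analytic_right :
      AnalyticOnNhd ℂ (fun w : ℂ => (1 / w) ^ (s : ℂ) * (Real.Gamma s : ℂ)) U := by
    refine DifferentiableOn.analyticOnNhd (fun w hw => ?_) hU
    have hw' : 0 < w.re := hw
    have hw0 : w ≠ 0 := by rintro rfl; simp at hw'
    have slit : 1 / w ∈ Complex.slitPlane := by
      left
      rw [one_div, Complex.inv_re]
      exact div_pos hw' (Complex.normSq_pos.2 hw0)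
    refine DifferentiableAt.differentiableWithinAt ?_
    refine DifferentiableAt.mul_const (DifferentiableAt.cpow_const ?_ slit) _
    exact (differentiableAt_const _).div differentiableAt_id hw0
  have preconn : IsPreconnected U :=
    (convex_halfSpace_re_gt 0).isPreconnected
  have eq_on_reals (r : ℝ) (hr : 0 < r) :
      ProbabilityTheory.complexMGF (fun t : ℝ => -t) m r =
        (1 / (r : ℂ)) ^ (s : ℂ) * (Real.Gamma s : ℂ) := by
    rw [mgf_eq, ← Complex.Gamma_ofReal,
      ← Complex.integral_cpow_mul_exp_neg_mul_Ioi (by simpa using hs) hr]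
    refine setIntegral_congr_fun measurableSet_Ioi fun t ht => ?_
    simp only [Complex.ofReal_cpow (le_of_lt ht), Complex.ofReal_sub, Complex.ofReal_one]
  have frequently : ∃ᶠ w in nhdsWithin (1 : ℂ) {1}ᶜ,
      ProbabilityTheory.complexMGF (fun t : ℝ => -t) m w =
        (1 / w) ^ (s : ℂ) * (Real.Gamma s : ℂ) := by
    have tends : Filter.Tendsto (fun r : ℝ => (r : ℂ)) (nhdsWithin 1 {1}ᶜ)
        (nhdsWithin (1 : ℂ) {1}ᶜ) := by
      refine tendsto_nhdsWithin_iff.2 ⟨?_, ?_⟩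
      · exact (Complex.continuous_ofReal.tendsto' 1 1 (by simp)).mono_left nhdsWithin_le_nhds
      · filter_upwards [self_mem_nhdsWithin] with r hr
        simpa using hr
    refine tends.frequently (Filter.Eventually.frequently ?_)
    filter_upwards [nhdsWithin_le_nhds (lt_mem_nhds (zero_lt_one' ℝ))] with r hr
    exact eq_on_reals r hr
  rw [← mgf_eq]
  exact analytic_left.eqOn_of_preconnected_of_frequently_eq analytic_right preconn
    (z₀ := 1) (by simp [U]) frequently hz

/-- Integrability of the kernel whose two iterated integrals evaluate the Stieltjes integral. -/
lemma integrable_rpow_mul_rpow_mul_cexp {a s : ℝ} (hs : 0 < s) (hsa : s < a) {z : ℂ}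
    (hz : 0 < z.re) :
    Integrable (fun p : ℝ × ℝ => ((p.1 ^ (s - 1) : ℝ) : ℂ) *
        (((p.2 ^ (a - 1) : ℝ) : ℂ) * Complex.exp (-((1 + z * p.1) * p.2))))
      ((volume.restrict (Ioi 0)).prod (volume.restrict (Ioi 0))) := by
  have meas : Measurable (fun p : ℝ × ℝ => ((p.1 ^ (s - 1) : ℝ) : ℂ) *
        (((p.2 ^ (a - 1) : ℝ) : ℂ) * Complex.exp (-((1 + z * p.1) * p.2)))) := by fun_prop
  have norm_eq {u x : ℝ} (hu : 0 < u) (hx : 0 < x) :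
      ‖((u ^ (s - 1) : ℝ) : ℂ) *
        (((x ^ (a - 1) : ℝ) : ℂ) * Complex.exp (-((1 + z * u) * x)))‖ =
      x ^ (a - 1) * Real.exp (-x) * (u ^ (s - 1) * Real.exp (-((z.re * x) * u))) := by
    have hre : (-((1 + z * u) * (x : ℂ))).re = -x + -((z.re * x) * u) := by
      simp; ring
    rw [norm_mul, norm_mul, Complex.norm_exp, hre, Real.exp_add, Complex.norm_real,
      Complex.norm_real, Real.norm_of_nonneg (by positivity), Real.norm_of_nonneg (by positivity)]
    ring
  rw [integrable_prod_iff' meas.aestronglyMeasurable]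
  constructor
  · filter_upwards [ae_restrict_mem measurableSet_Ioi] with x hx
    have hx : 0 < x := hx
    refine (integrable_norm_iff (by fun_prop)).1 ?_
    refine IntegrableOn.congr_fun
      ((integrableOn_rpow_mul_exp_neg_mul hs (mul_pos hz hx)).const_mul
        (x ^ (a - 1) * Real.exp (-x))) (fun u hu => ?_) measurableSet_Ioi
    exact (norm_eq hu hx).symm
  · have hgamma := (integrableOn_rpow_mul_exp_neg_mul (sub_pos.2 hsa) one_pos).const_mul
      ((1 / z.re) ^ s * Real.Gamma s)
    refine IntegrableOn.congr_fun hgamma (fun x hx => ?_) measurableSet_Ioi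
    have hx : 0 < x := hx
    rw [setIntegral_congr_fun measurableSet_Ioi (fun u hu => norm_eq hu hx), integral_const_mul,
      Real.integral_rpow_mul_exp_neg_mul_Ioi hs (mul_pos hz hx),
      ← one_div_mul_one_div, Real.mul_rpow (by positivity) (by positivity), one_div x,
      Real.inv_rpow hx.le, ← Real.rpow_neg hx.le, one_mul, (by ring : a - s - 1 = (a - 1) + -s), Real.rpow_add hx]
    ring

lemma inner_rpow_mul_cexp {a : ℝ} (ha : 0 < a) {z : ℂ} (hz : 0 < z.re) {s u : ℝ} (hu : 0 < u) :
    ∫ x in Ioi (0 : ℝ), ((u ^ (s - 1) : ℝ) : ℂ) *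
        (((x ^ (a - 1) : ℝ) : ℂ) * Complex.exp (-((1 + z * u) * x))) =
      ((u ^ (s - 1) : ℝ) : ℂ) * (1 / (1 + z * u)) ^ (a : ℂ) * (Real.Gamma a : ℂ) := by
  have : 0 < (1 + z * (u : ℂ)).re := by simp; positivity
  rw [integral_const_mul, integral_rpow_mul_cexp_neg_mul_Ioi ha this, mul_assoc]

lemma integrableOn_rpow_mul_one_add_mul_cpow {a s : ℝ} (hs : 0 < s) (hsa : s < a) {z : ℂ}
    (hz : 0 < z.re) :
    IntegrableOn (fun u : ℝ => ((u ^ (s - 1) : ℝ) : ℂ) * (1 / (1 + z * u)) ^ (a : ℂ))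
      (Ioi 0) := by
  have ha := hs.trans hsa
  have hΓ : (Real.Gamma a : ℂ) ≠ 0 := by exact_mod_cast (Real.Gamma_pos_of_pos ha).ne'
  have h := (integrable_rpow_mul_rpow_mul_cexp hs hsa hz).integral_prod_left
  refine IntegrableOn.congr_fun (h.div_const (Real.Gamma a : ℂ)) (fun u hu => ?_)
    measurableSet_Ioi
  simp only [inner_rpow_mul_cexp ha hz (mem_Ioi.1 hu)]
  field_simp

lemma integral_rpow_mul_one_add_mul_cpow {a s : ℝ} (hs : 0 < s) (hsa : s < a) {z : ℂ}
    (hz : 0 < z.re) :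
    ∫ u in Ioi (0 : ℝ), ((u ^ (s - 1) : ℝ) : ℂ) * (1 / (1 + z * u)) ^ (a : ℂ) =
      (1 / z) ^ (s : ℂ) *
        ((Real.Gamma (a - s) * Real.Gamma s / Real.Gamma a : ℝ) : ℂ) := by
  have ha := hs.trans hsa
  have hΓ : (Real.Gamma a : ℂ) ≠ 0 := by exact_mod_cast (Real.Gamma_pos_of_pos ha).ne'
  have swap := integral_integral_swap
    (f := fun u x : ℝ => ((u ^ (s - 1) : ℝ) : ℂ) *
        (((x ^ (a - 1) : ℝ) : ℂ) * Complex.exp (-((1 + z * u) * x))))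
    (integrable_rpow_mul_rpow_mul_cexp hs hsa hz)
  rw [setIntegral_congr_fun measurableSet_Ioi (fun u hu => inner_rpow_mul_cexp ha hz hu),
    integral_mul_const] at swap
  have inner {x : ℝ} (hx : x ∈ Ioi (0 : ℝ)) :
      ∫ u in Ioi (0 : ℝ), ((u ^ (s - 1) : ℝ) : ℂ) *
        (((x ^ (a - 1) : ℝ) : ℂ) * Complex.exp (-((1 + z * u) * x))) =
      (1 / z) ^ (s : ℂ) * (Real.Gamma s : ℂ) *
        ((x ^ (a - s - 1) : ℝ) * Complex.exp (-((1 : ℂ) * x))) := by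
    have hx : 0 < x := hx
    have hz0 : z ≠ 0 := by rintro rfl; simp at hz
    have hzx : 0 < (z * (x : ℂ)).re := by simp; positivity
    have split (u : ℝ) : ((u ^ (s - 1) : ℝ) : ℂ) *
        (((x ^ (a - 1) : ℝ) : ℂ) * Complex.exp (-((1 + z * u) * x))) =
        ((x ^ (a - 1) : ℝ) : ℂ) * Complex.exp (-((1 : ℂ) * x)) *
          (((u ^ (s - 1) : ℝ) : ℂ) * Complex.exp (-((z * x) * u))) := by
      rw [(by ring : -((1 + z * u) * (x : ℂ)) = -((1 : ℂ) * x) + -((z * x) * u)), Complex.exp_add]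
      ring
    have hpow : (1 / (z * (x : ℂ))) ^ (s : ℂ) = (1 / z) ^ (s : ℂ) * ((x ^ (-s) : ℝ) : ℂ) := by
      have h1 : 1 / (z * (x : ℂ)) = ((x⁻¹ : ℝ) : ℂ) * (1 / z) := by push_cast; field_simp
      rw [h1, ofReal_mul_cpow (inv_pos.2 hx) (one_div_ne_zero hz0), Real.inv_rpow hx.le,
        ← Real.rpow_neg hx.le, mul_comm]
    simp_rw [split]
    rw [integral_const_mul, integral_rpow_mul_cexp_neg_mul_Ioi hs hzx, hpow,
      (by ring : a - s - 1 = (a - 1) + -s), Real.rpow_add hx]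
    push_cast
    ring
  rw [setIntegral_congr_fun measurableSet_Ioi (fun x hx => inner hx), integral_const_mul,
    integral_rpow_mul_cexp_neg_mul_Ioi (sub_pos.2 hsa) (by simp)] at swap
  rw [eq_div_of_mul_eq hΓ swap]
  simp
  ring

lemma half_one_add_le_norm {ε u : ℝ} (hε : 0 ≤ ε) (hu : 0 ≤ u) :
    (1 + u) / 2 ≤ ‖1 + ((ε : ℂ) - Complex.I) * u‖ := by
  have hre : (1 + ((ε : ℂ) - Complex.I) * u).re = 1 + ε * u := by simp
  have him : (1 + ((ε : ℂ) - Complex.I) * u).im = -u := by simp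
  have h1 := Complex.abs_re_le_norm (1 + ((ε : ℂ) - Complex.I) * u)
  have h2 := Complex.abs_im_le_norm (1 + ((ε : ℂ) - Complex.I) * u)
  rw [hre] at h1
  rw [him, abs_neg] at h2
  nlinarith [le_abs_self (1 + ε * u), le_abs_self u, mul_nonneg hε hu]

lemma norm_rpow_mul_cpow_le {a s ε u : ℝ} (ha : 0 < a) (hε : 0 ≤ ε) (hu : 0 < u) :
    ‖((u ^ (s - 1) : ℝ) : ℂ) * (1 / (1 + ((ε : ℂ) - Complex.I) * u)) ^ (a : ℂ)‖ ≤
      2 ^ a * ‖((u ^ (s - 1) : ℝ) : ℂ) * (1 / (1 + (1 : ℂ) * u)) ^ (a : ℂ)‖ := by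
  have hlow := half_one_add_le_norm hε hu.le
  have hpos : 0 < (1 + u) / 2 := by positivity
  have h0 : 1 + ((ε : ℂ) - Complex.I) * u ≠ 0 := norm_pos_iff.1 (hpos.trans_le hlow)
  have hone : (1 / (1 + (1 : ℂ) * u)) = ((1 / (1 + u) : ℝ) : ℂ) := by push_cast; ring
  rw [hone, norm_mul, norm_mul, Complex.norm_cpow_of_ne_zero (one_div_ne_zero h0),
    Complex.norm_cpow_eq_rpow_re_of_pos (by positivity), mul_left_comm]
  simp only [Complex.ofReal_re, Complex.ofReal_im, mul_zero, Real.exp_zero, div_one]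
  rw [← Real.mul_rpow zero_le_two (by positivity)]
  refine mul_le_mul_of_nonneg_left (Real.rpow_le_rpow (norm_nonneg _) ?_ ha.le) (norm_nonneg _)
  rw [norm_div, norm_one]
  calc 1 / ‖1 + ((ε : ℂ) - Complex.I) * u‖ ≤ 1 / ((1 + u) / 2) :=
        one_div_le_one_div_of_le hpos hlow
    _ = 2 * (1 / (1 + u)) := by field_simp

lemma integrableOn_two_rpow_mul_norm {a s : ℝ} (hs : 0 < s) (hsa : s < a) :
    IntegrableOn (fun u : ℝ =>
      2 ^ a * ‖((u ^ (s - 1) : ℝ) : ℂ) * (1 / (1 + (1 : ℂ) * u)) ^ (a : ℂ)‖) (Ioi 0) :=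
  (integrableOn_rpow_mul_one_add_mul_cpow hs hsa (by simp)).norm.const_mul _

lemma integrableOn_rpow_mul_one_sub_I_mul_cpow {a s : ℝ} (hs : 0 < s) (hsa : s < a) :
    IntegrableOn (fun u : ℝ =>
      ((u ^ (s - 1) : ℝ) : ℂ) * (1 / (1 + (((0 : ℝ) : ℂ) - Complex.I) * u)) ^ (a : ℂ)) (Ioi 0) := by
  refine (integrableOn_two_rpow_mul_norm hs hsa).mono' (by fun_prop) ?_
  filter_upwards [ae_restrict_mem measurableSet_Ioi] with u hu
  exact norm_rpow_mul_cpow_le (hs.trans hsa) le_rfl hu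

lemma integral_rpow_mul_one_sub_I_mul_cpow {a s : ℝ} (hs : 0 < s) (hsa : s < a) :
    ∫ u in Ioi (0 : ℝ),
        ((u ^ (s - 1) : ℝ) : ℂ) * (1 / (1 + (((0 : ℝ) : ℂ) - Complex.I) * u)) ^ (a : ℂ) =
      Complex.I ^ (s : ℂ) *
        ((Real.Gamma (a - s) * Real.Gamma s / Real.Gamma a : ℝ) : ℂ) := by
  have ha := hs.trans hsa
  have lim_left := tendsto_integral_filter_of_dominated_convergence
    (μ := volume.restrict (Ioi (0 : ℝ))) (l := nhdsWithin (0 : ℝ) (Ioi 0))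
    (F := fun ε u : ℝ =>
      ((u ^ (s - 1) : ℝ) : ℂ) * (1 / (1 + ((ε : ℂ) - Complex.I) * u)) ^ (a : ℂ))
    (f := fun u : ℝ =>
      ((u ^ (s - 1) : ℝ) : ℂ) * (1 / (1 + (((0 : ℝ) : ℂ) - Complex.I) * u)) ^ (a : ℂ))
    _ (Filter.Eventually.of_forall fun ε => by fun_prop)
    (by
      filter_upwards [self_mem_nhdsWithin] with ε hε
      filter_upwards [ae_restrict_mem measurableSet_Ioi] with u hu
      exact norm_rpow_mul_cpow_le ha (le_of_lt hε) hu)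
    (integrableOn_two_rpow_mul_norm hs hsa)
    (by
      filter_upwards with u
      refine (ContinuousAt.tendsto (x := (0 : ℝ)) ?_).mono_left nhdsWithin_le_nhds
      have hre : (1 + (((0 : ℝ) : ℂ) - Complex.I) * u).re = 1 := by simp
      have h0 : 1 + (((0 : ℝ) : ℂ) - Complex.I) * u ≠ 0 := by
        intro h
        rw [h, Complex.zero_re] at hre
        exact zero_ne_one hre
      refine ContinuousAt.mul continuousAt_const (ContinuousAt.cpow ?_ continuousAt_const ?_)
      · exact ContinuousAt.div continuousAt_const (by fun_prop) h0
      · left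
        rw [one_div, Complex.inv_re, hre]
        exact div_pos one_pos (Complex.normSq_pos.2 h0))
  have lim_right : Filter.Tendsto (fun ε : ℝ => (1 / ((ε : ℂ) - Complex.I)) ^ (s : ℂ) *
      ((Real.Gamma (a - s) * Real.Gamma s / Real.Gamma a : ℝ) : ℂ))
      (nhdsWithin (0 : ℝ) (Ioi 0)) (nhds (Complex.I ^ (s : ℂ) *
        ((Real.Gamma (a - s) * Real.Gamma s / Real.Gamma a : ℝ) : ℂ))) := by
    have hI : 1 / (((0 : ℝ) : ℂ) - Complex.I) = Complex.I := by simp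
    have hcont : ContinuousAt (fun ε : ℝ => (1 / ((ε : ℂ) - Complex.I)) ^ (s : ℂ) *
        ((Real.Gamma (a - s) * Real.Gamma s / Real.Gamma a : ℝ) : ℂ)) 0 := by
      refine ContinuousAt.mul (ContinuousAt.cpow ?_ continuousAt_const ?_) continuousAt_const
      · exact ContinuousAt.div continuousAt_const (by fun_prop) (by simp)
      · rw [hI]
        simp [Complex.slitPlane]
    have := hcont.tendsto
    rw [hI] at this
    exact this.mono_left nhdsWithin_le_nhds
  refine tendsto_nhds_unique lim_left (lim_right.congr' ?_)
  filter_upwards [self_mem_nhdsWithin] with ε hε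
  exact (integral_rpow_mul_one_add_mul_cpow hs hsa (by simpa using hε)).symm

lemma im_one_sub_I_mul_cpow (a u : ℝ) :
    ((1 / (1 + (((0 : ℝ) : ℂ) - Complex.I) * u)) ^ (a : ℂ)).im =
      (1 + u ^ 2) ^ (-(a / 2)) * Real.sin (a * Real.arctan u) := by
  have hpos : 0 < 1 + u ^ 2 := by positivity
  have hsq : √(1 + u ^ 2) ^ 2 = 1 + u ^ 2 := Real.sq_sqrt hpos.le
  have hsqrt : 0 < √(1 + u ^ 2) := Real.sqrt_pos.2 hpos
  have polar : 1 / (1 + (((0 : ℝ) : ℂ) - Complex.I) * u) =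
      (((√(1 + u ^ 2))⁻¹ : ℝ) : ℂ) * Complex.exp (Real.arctan u * Complex.I) := by
    have h0 : 1 + (((0 : ℝ) : ℂ) - Complex.I) * u ≠ 0 := by
      intro h
      simpa using congrArg Complex.re h
    rw [Complex.exp_mul_I, ← Complex.ofReal_cos, ← Complex.ofReal_sin, Real.cos_arctan,
      Real.sin_arctan, div_eq_iff h0]
    apply Complex.ext
    · simp
      field_simp
      rw [hsq]
    · simp
      field_simp
      ring
  have hlog : Complex.log (Complex.exp (Real.arctan u * Complex.I)) =
      Real.arctan u * Complex.I := by
    have him : (Real.arctan u * Complex.I).im = Real.arctan u := by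
      rw [Complex.im_ofReal_mul, Complex.I_im, mul_one]
    apply Complex.log_exp <;> rw [him]
    · linarith [Real.neg_pi_div_two_lt_arctan u, Real.pi_pos]
    · linarith [Real.arctan_lt_pi_div_two u, Real.pi_pos]
  have hexp : Complex.exp (Real.arctan u * Complex.I) ^ (a : ℂ) =
      Complex.exp (((a * Real.arctan u : ℝ) : ℂ) * Complex.I) := by
    rw [Complex.cpow_def_of_ne_zero (Complex.exp_ne_zero _), hlog]
    push_cast
    ring_nf
  rw [polar, ofReal_mul_cpow (inv_pos.2 hsqrt) (Complex.exp_ne_zero _), hexp,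
    Complex.im_ofReal_mul, Complex.exp_ofReal_mul_I_im, Real.inv_rpow hsqrt.le,
    Real.sqrt_eq_rpow, ← Real.rpow_mul hpos.le, ← Real.rpow_neg hpos.le]
  ring_nf

lemma im_I_cpow (s : ℝ) : (Complex.I ^ (s : ℂ)).im = Real.sin (Real.pi / 2 * s) := by
  rw [Complex.cpow_def_of_ne_zero Complex.I_ne_zero, Complex.log_I,
    (by push_cast; ring : (Real.pi : ℂ) / 2 * Complex.I * s =
      ((Real.pi / 2 * s : ℝ) : ℂ) * Complex.I), Complex.exp_ofReal_mul_I_im]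

lemma integral_rpow_mul_rpow_mul_sin_arctan {a s : ℝ} (hs : 0 < s) (hsa : s < a) :
    ∫ u in Ioi (0 : ℝ),
        u ^ (s - 1) * ((1 + u ^ 2) ^ (-(a / 2)) * Real.sin (a * Real.arctan u)) =
      Real.Gamma (a - s) * Real.Gamma s / Real.Gamma a * Real.sin (Real.pi / 2 * s) := by
  have h := integral_im (integrableOn_rpow_mul_one_sub_I_mul_cpow hs hsa)
  rw [integral_rpow_mul_one_sub_I_mul_cpow hs hsa] at h
  simpa only [RCLike.im_to_complex, Complex.im_ofReal_mul, Complex.im_mul_ofReal,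
    im_one_sub_I_mul_cpow, im_I_cpow, mul_comm (Real.sin _)] using h

theorem gen_stieltjes_of_power_sin_arctan (α δ μ ν y : ℝ)
    (hμ : 0 < μ) (hy : 0 < y) (hα : μ < α)
    (h1 : 0 < (δ - ν) / μ) (h2 : (δ - ν) / μ < 2) (h3 : 0 < (α - δ + ν) / μ) :
    ∫ t in Ioi (0:ℝ), t ^ (δ - ν - 1) * (y ^ (2 * μ) + t ^ (2 * μ)) ^ (-(α / (2 * μ))) *
        Real.sin ((α / μ) * Real.arctan (t ^ μ / y ^ μ))
      = (1 / (μ * y ^ (α + ν - δ))) *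
        (Real.Gamma ((α - δ + ν) / μ) * Real.Gamma ((δ - ν) / μ) /
          Real.Gamma ((α - δ + ν) / μ + (δ - ν) / μ)) *
        Real.sin ((Real.pi / 2) * ((δ - ν) / μ)) := by
  have ha : (α - δ + ν) / μ + (δ - ν) / μ = α / μ := by ring
  have has : (α - δ + ν) / μ = α / μ - (δ - ν) / μ := by ring
  have hsa : (δ - ν) / μ < α / μ := by linarith
  rw [ha, has]
  set a := α / μ with ha_def
  set s := (δ - ν) / μ with hs_def
  let g : ℝ → ℝ := fun u =>
    u ^ (s - 1) * ((1 + u ^ 2) ^ (-(a / 2)) * Real.sin (a * Real.arctan u))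
  let h : ℝ → ℝ := fun t => (|μ| * t ^ (μ - 1)) • g (t ^ μ)
  have hα_eq : α = μ * a := by rw [ha_def]; field_simp
  have hδ_eq : δ - ν = μ * s := by rw [hs_def]; field_simp
  have hexp : α + ν - δ = μ * a - μ * s := by linarith
  have key {t : ℝ} (ht : t ∈ Ioi (0 : ℝ)) :
      t ^ (δ - ν - 1) * (y ^ (2 * μ) + t ^ (2 * μ)) ^ (-(α / (2 * μ))) *
        Real.sin (a * Real.arctan (t ^ μ / y ^ μ)) =
      (y⁻¹ / (μ * y ^ (α + ν - δ))) * h (y⁻¹ * t) := by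
    have ht : 0 < t := ht
    obtain ⟨x, rfl⟩ : ∃ x, t = y * x := ⟨t / y, by field_simp⟩
    have hx : 0 < x := (pos_iff_pos_of_mul_pos ht).1 hy
    have hy1 : y⁻¹ * (y * x) = x := by field_simp
    have hquot : (y * x) ^ μ / y ^ μ = x ^ μ := by
      rw [Real.mul_rpow hy.le hx.le]
      field_simp
    have hsum : y ^ (2 * μ) + (y * x) ^ (2 * μ) = y ^ (2 * μ) * (1 + (x ^ μ) ^ 2) := by
      rw [Real.mul_rpow hy.le hx.le, ← Real.rpow_natCast, ← Real.rpow_mul hx.le, mul_comm μ]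
      push_cast
      ring
    have hhalf : α / (2 * μ) = a / 2 := by rw [ha_def]; field_simp
    have hypow : y ^ (μ * s - 1) * (y ^ (2 * μ)) ^ (-(a / 2)) =
        y⁻¹ / y ^ (μ * a - μ * s) := by
      rw [← Real.rpow_mul hy.le, ← Real.rpow_neg_one, ← Real.rpow_add hy, ← Real.rpow_sub hy]
      ring_nf
    have hxpow : x ^ (μ * s - 1) = x ^ (μ - 1) * (x ^ μ) ^ (s - 1) := by
      rw [← Real.rpow_mul hx.le, ← Real.rpow_add hx]
      ring_nf
    rw [hy1, hquot, hsum, hhalf, hδ_eq, hexp, Real.mul_rpow hy.le hx.le,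
      Real.mul_rpow (by positivity) (by positivity), hxpow]
    simp only [h, g, smul_eq_mul, abs_of_pos hμ]
    calc _ = (y ^ (μ * s - 1) * (y ^ (2 * μ)) ^ (-(a / 2))) * (x ^ (μ - 1) * (x ^ μ) ^ (s - 1) *
          ((1 + (x ^ μ) ^ 2) ^ (-(a / 2)) * Real.sin (a * Real.arctan (x ^ μ)))) := by ring
      _ = _ := by
        rw [hypow]
        field_simp
  rw [setIntegral_congr_fun measurableSet_Ioi (fun t ht => key ht), integral_const_mul,
    integral_comp_mul_left_Ioi h 0 (inv_pos.2 hy), mul_zero, integral_comp_rpow_Ioi g hμ.ne',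
    integral_rpow_mul_rpow_mul_sin_arctan h1 hsa, smul_eq_mul, inv_inv]
  field_simp
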